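/- arXiv:1608.01832 — 2 statements merged into one kernel-verified Lean document; each statement's English description precedes it below -/
import Mathlib

section
/- For all real numbers σ > 0 and r > 0, one has ∫_{-1}^{1} u · exp(−(2 r² (1−u))/(2σ²)) du = (σ²/r²) · (1 + exp(−2r²/σ²)) · (1 − (σ²/r²) · tanh(r²/σ²)). -/
/-- Integration by parts for a linear factor against a shifted exponential. -/
theorem integral_mul_exp_neg_mul_one_sub {a : ℝ} (ha : a ≠ 0) :
    (∫ u in (-1 : ℝ)..1, u * Real.exp (-(a * (1 - u))))
      = (1 / a - 1 / a ^ 2) + (1 / a + 1 / a ^ 2) * Real.exp (-(2 * a)) := by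
  have hderiv (u : ℝ) : HasDerivAt (fun u => (u / a - 1 / a ^ 2) * Real.exp (-(a * (1 - u))))
      (u * Real.exp (-(a * (1 - u)))) u := by
    have hexp : HasDerivAt (fun u : ℝ => Real.exp (-(a * (1 - u))))
        (Real.exp (-(a * (1 - u))) * -(a * -1)) u :=
      (((hasDerivAt_id u).const_sub 1).const_mul a).neg.exp
    refine ((((hasDerivAt_id u).div_const a).sub_const (1 / a ^ 2)).mul hexp).congr_deriv ?_
    simp only [id]
    field_simp
    ring
  rw [intervalIntegral.integral_eq_sub_of_hasDerivAt (fun u _ => hderiv u)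
    (Continuous.intervalIntegrable (by fun_prop) _ _)]
  rw [show -(a * (1 - 1)) = 0 by ring, show -(a * (1 - -1)) = -(2 * a) by ring, Real.exp_zero]
  ring

/-- The hyperbolic tangent in terms of `exp (-2a)`, with the denominator cleared. -/
theorem one_add_exp_mul_tanh (a : ℝ) :
    (1 + Real.exp (-(2 * a))) * Real.tanh a = 1 - Real.exp (-(2 * a)) := by
  rw [Real.tanh_eq_sinh_div_cosh, Real.sinh_eq, Real.cosh_eq,
    show -(2 * a) = -a + -a by ring, Real.exp_add, Real.exp_neg]
  field_simp

/-- For the Gaussian kernel `k_V(u) = exp(−u/(2σ²))`, the function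
`χ(r)/(4π) = ∫_{-1}^{1} u · k_V(2r²(1−u)) du` evaluates explicitly:
for all `σ > 0` and `r > 0`,
`∫_{-1}^{1} u · exp(−(2r²(1−u))/(2σ²)) du
  = (σ²/r²) · (1 + exp(−2r²/σ²)) · (1 − (σ²/r²) · tanh(r²/σ²))`. -/
theorem stmt_0 (σ r : ℝ) (hσ : 0 < σ) (hr : 0 < r) :
    (∫ u in (-1 : ℝ)..1, u * Real.exp (-(2 * r ^ 2 * (1 - u)) / (2 * σ ^ 2)))
      = σ ^ 2 / r ^ 2 * (1 + Real.exp (-(2 * r ^ 2) / σ ^ 2)) *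
        (1 - σ ^ 2 / r ^ 2 * Real.tanh (r ^ 2 / σ ^ 2)) := by
  have ha : r ^ 2 / σ ^ 2 ≠ 0 := by positivity
  have hinv : σ ^ 2 / r ^ 2 = 1 / (r ^ 2 / σ ^ 2) := (one_div_div _ _).symm
  have hexp (u : ℝ) : -(2 * r ^ 2 * (1 - u)) / (2 * σ ^ 2) = -(r ^ 2 / σ ^ 2 * (1 - u)) := by
    field_simp
  have hexp' : -(2 * r ^ 2) / σ ^ 2 = -(2 * (r ^ 2 / σ ^ 2)) := by ring
  simp only [hexp, hexp', hinv]
  rw [integral_mul_exp_neg_mul_one_sub ha]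
  generalize r ^ 2 / σ ^ 2 = a
  linear_combination (1 / a ^ 2) * one_add_exp_mul_tanh a
end

section
/- Let γ_V > 0, γ_f > 0, p^f ∈ ℝ, let χ : ℝ → ℝ be differentiable, and let r, ρ, f : I → ℝ be differentiable functions on an open interval I with r_t > 0 for all t ∈ I, satisfying the system ḟ_t = p^f/(γ_f r_t²), ṙ_t = (1/γ_V) χ(r_t) ρ_t, and ρ̇_t = −(1/(2γ_V)) χ'(r_t) ρ_t² + (p^f)²/(γ_f r_t³). Then the function t ↦ (1/(2γ_V)) χ(r_t) ρ_t² + (p^f)²/(2 γ_f r_t²) is constant on I. -/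
/-- Conservation of the reduced Hamiltonian along the sphere-metamorphosis
geodesic system: if `ḟ_t = p^f/(γ_f r_t²)`, `ṙ_t = (1/γ_V) χ(r_t) ρ_t` and
`ρ̇_t = −(1/(2γ_V)) χ'(r_t) ρ_t² + (p^f)²/(γ_f r_t³)` on an open interval `I`
with `r_t > 0`, then `t ↦ (1/(2γ_V)) χ(r_t) ρ_t² + (p^f)²/(2 γ_f r_t²)`
is constant on `I`. -/
theorem stmt_3 (γV γf pf : ℝ) (hγV : 0 < γV) (hγf : 0 < γf)
    (χ : ℝ → ℝ) (hχ : Differentiable ℝ χ)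
    (a b : ℝ) (r ρ f : ℝ → ℝ)
    (hrpos : ∀ t ∈ Set.Ioo a b, 0 < r t)
    (hf : ∀ t ∈ Set.Ioo a b, HasDerivAt f (pf / (γf * (r t) ^ 2)) t)
    (hr : ∀ t ∈ Set.Ioo a b, HasDerivAt r (1 / γV * χ (r t) * ρ t) t)
    (hρ : ∀ t ∈ Set.Ioo a b, HasDerivAt ρ
      (-(1 / (2 * γV)) * deriv χ (r t) * (ρ t) ^ 2 + pf ^ 2 / (γf * (r t) ^ 3)) t) :
    ∀ t ∈ Set.Ioo a b, ∀ t' ∈ Set.Ioo a b,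
      1 / (2 * γV) * χ (r t) * (ρ t) ^ 2 + pf ^ 2 / (2 * γf * (r t) ^ 2)
        = 1 / (2 * γV) * χ (r t') * (ρ t') ^ 2 + pf ^ 2 / (2 * γf * (r t') ^ 2) := by
  have hH : ∀ t ∈ Set.Ioo a b, HasDerivAt
      (fun t => 1 / (2 * γV) * χ (r t) * (ρ t) ^ 2 + pf ^ 2 / (2 * γf * (r t) ^ 2)) 0 t := by
    intro t ht
    have hr0 : r t ≠ 0 := (hrpos t ht).ne'
    have hχr : HasDerivAt (fun t => χ (r t)) (deriv χ (r t) * (1 / γV * χ (r t) * ρ t)) t :=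
      (hχ (r t)).hasDerivAt.comp t (hr t ht)
    have hden : 2 * γf * (r t) ^ 2 ≠ 0 := by positivity
    refine (((hχr.const_mul (1 / (2 * γV))).fun_mul ((hρ t ht).fun_pow 2)).fun_add
      ((hasDerivAt_const t (pf ^ 2)).fun_div
        (((hr t ht).fun_pow 2).const_mul (2 * γf)) hden)).congr_deriv ?_
    field_simp
    ring
  intro t ht t' ht'
  exact isOpen_Ioo.is_const_of_deriv_eq_zero isPreconnected_Ioo
    (fun s hs => (hH s hs).differentiableAt.differentiableWithinAt)
    (fun s hs => (hH s hs).deriv) ht ht'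
end
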